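/- (Abstract core of the paper's Theorem on convergence of BSVGD.) Let χ : ℝ^d → ℝ≥0 be locally integrable, and let (μ_n) be a sequence of probability measures on ℝ^d with uniformly bounded second moments. Suppose that for each n there exists a probability measure ν_n, absolutely continuous with respect to Lebesgue measure with density bounded almost everywhere by χ, and a coupling π_n of μ_n and ν_n with ∫ |x − y|² dπ_n(x,y) → 0 as n → ∞. Then every weakly convergent subsequence of (μ_n) converges to a probability measure τ that is absolutely continuous with respect to Lebesgue measure with density bounded almost everywhere by χ; moreover at least one such weakly convergent subsequence exists. -/

import Mathlib

open MeasureTheory Filter Topology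

open scoped ENNReal NNReal

section Auxiliary

variable {E : Type*} [NormedAddCommGroup E] [MeasurableSpace E] [BorelSpace E]

theorem measure_map_fst_compl_cthickening_le [SecondCountableTopology E]
    (π : Measure (E × E)) {U : Set E} (hU : IsOpen U) {δ : ℝ} (hδ : 0 < δ) :
    π.map Prod.fst (Metric.cthickening δ Uᶜ)ᶜ ≤
      π.map Prod.snd U +
        (∫⁻ p, (‖p.1 - p.2‖₊ : ℝ≥0∞) ^ 2 ∂π) / ENNReal.ofReal δ ^ 2 := by
  have hopen : IsOpen (Metric.cthickening δ Uᶜ)ᶜ := Metric.isClosed_cthickening.isOpen_compl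
  rw [Measure.map_apply measurable_fst hopen.measurableSet,
    Measure.map_apply measurable_snd hU.measurableSet]
  have hsub : Prod.fst ⁻¹' (Metric.cthickening δ Uᶜ)ᶜ ⊆ (Prod.snd ⁻¹' U) ∪
      {p : E × E | ENNReal.ofReal δ ^ 2 ≤ (‖p.1 - p.2‖₊ : ℝ≥0∞) ^ 2} := by
    rintro ⟨x, y⟩ hx
    by_cases hy : y ∈ U
    · exact Or.inl hy
    · right
      have hlt : ENNReal.ofReal δ ≤ (‖x - y‖₊ : ℝ≥0∞) := by
        by_contra! h
        refine hx (Metric.mem_cthickening_of_edist_le x y δ Uᶜ hy ?_)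
        rw [edist_eq_enorm_sub]
        exact h.le
      exact pow_le_pow_left' hlt 2
  refine (measure_mono hsub).trans ((measure_union_le _ _).trans ?_)
  gcongr
  exact meas_ge_le_lintegral_div (by fun_prop) (by simpa using hδ) (by finiteness)

theorem isLocallyFiniteMeasure_withDensity_of_locallyIntegrable {m : Measure E} {χ : E → ℝ≥0}
    (hχ : LocallyIntegrable (fun x => (χ x : ℝ)) m) :
    IsLocallyFiniteMeasure (m.withDensity fun x => (χ x : ℝ≥0∞)) := by
  refine ⟨fun x => ?_⟩
  obtain ⟨s, hs, hint⟩ := hχ x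
  obtain ⟨t, hts, ht, hxt⟩ := mem_nhds_iff.1 hs
  refine ⟨t, ht.mem_nhds hxt, ?_⟩
  rw [withDensity_apply _ ht.measurableSet]
  refine (lintegral_mono_set hts).trans_lt ?_
  simpa [HasFiniteIntegral, enorm_eq_nnnorm] using hint.2

theorem le_of_coupling_of_tendsto_zero [SecondCountableTopology E]
    {m : Measure E} [m.OuterRegular] {τ : ProbabilityMeasure E} {μ : ℕ → ProbabilityMeasure E}
    (hμ : Tendsto μ atTop (𝓝 τ)) {π : ℕ → Measure (E × E)}
    (hfst : ∀ n, (π n).map Prod.fst = μ n) (hsnd : ∀ n, (π n).map Prod.snd ≤ m)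
    (hcost : Tendsto (fun n => ∫⁻ p, (‖p.1 - p.2‖₊ : ℝ≥0∞) ^ 2 ∂(π n)) atTop (𝓝 0)) :
    (τ : Measure E) ≤ m := by
  have hthick {U : Set E} (hU : IsOpen U) {δ : ℝ} (hδ : 0 < δ) :
      (τ : Measure E) (Metric.cthickening δ Uᶜ)ᶜ ≤ m U := by
    refine (ProbabilityMeasure.le_liminf_measure_open_of_tendsto hμ
      Metric.isClosed_cthickening.isOpen_compl).trans ?_
    have hlim : Tendsto (fun n => m U +
        (∫⁻ p, (‖p.1 - p.2‖₊ : ℝ≥0∞) ^ 2 ∂(π n)) / ENNReal.ofReal δ ^ 2) atTop (𝓝 (m U)) := by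
      have hdiv := ENNReal.Tendsto.div_const hcost (b := ENNReal.ofReal δ ^ 2)
        (Or.inr (by simpa using hδ))
      simpa using hdiv.const_add (m U)
    rw [← hlim.liminf_eq]
    refine liminf_le_liminf (Eventually.of_forall fun n => ?_)
    rw [← hfst n]
    exact (measure_map_fst_compl_cthickening_le (π n) hU hδ).trans (by gcongr; exact hsnd n)
  have hopen {U : Set E} (hU : IsOpen U) : (τ : Measure E) U ≤ m U := by
    obtain ⟨u, hu_anti, hu_pos, hu⟩ := exists_seq_strictAnti_tendsto (0 : ℝ)
    have hUnion : U = ⋃ n, (Metric.cthickening (u n) Uᶜ)ᶜ := by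
      have hcl := Metric.closure_eq_iInter_cthickening' Uᶜ (Set.range u) ?_
      · rw [hU.isClosed_compl.closure_eq, Set.biInter_range] at hcl
        rw [← Set.compl_iInter, ← hcl, compl_compl]
      intro ε hε
      obtain ⟨n, hn⟩ := (hu.eventually_le_const hε).exists
      exact ⟨u n, ⟨n, rfl⟩, hu_pos n, hn⟩
    have hmono : Monotone fun n => (Metric.cthickening (u n) Uᶜ)ᶜ := fun i j hij =>
      Set.compl_subset_compl.2 (Metric.cthickening_mono (hu_anti.antitone hij) _)
    conv_lhs => rw [hUnion]
    rw [hmono.measure_iUnion]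
    exact iSup_le fun n => hthick hU (hu_pos n)
  refine Measure.le_intro fun A _ _ => ?_
  rw [A.measure_eq_iInf_isOpen m]
  exact le_iInf₂ fun U hAU => le_iInf fun hU => (measure_mono hAU).trans (hopen hU)

theorem isTightMeasureSet_of_lintegral_nnnorm_sq_le [ProperSpace E] {S : Set (Measure E)}
    {C : ℝ≥0∞} (hC : C ≠ ∞) (hS : ∀ μ ∈ S, ∫⁻ x, (‖x‖₊ : ℝ≥0∞) ^ 2 ∂μ ≤ C) :
    IsTightMeasureSet S := by
  refine isTightMeasureSet_of_tendsto_measure_norm_gt ?_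
  have hlim : Tendsto (fun r : ℝ => C / ENNReal.ofReal r ^ 2) atTop (𝓝 0) := by
    have hpow : Tendsto (fun r : ℝ => ENNReal.ofReal r ^ 2) atTop (𝓝 ∞) := by
      simpa [Function.comp_def] using ((ENNReal.continuous_pow 2).tendsto ∞).comp ENNReal.tendsto_ofReal_atTop
    simpa using ENNReal.Tendsto.const_div hpow (Or.inr hC)
  refine tendsto_of_tendsto_of_tendsto_of_le_of_le' tendsto_const_nhds hlim
    (Eventually.of_forall fun _ => zero_le) ?_
  filter_upwards [eventually_gt_atTop 0] with r hr
  refine iSup₂_le fun μ hμ => ?_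
  have hsub : {x : E | r < ‖x‖} ⊆ {x | ENNReal.ofReal r ^ 2 ≤ (‖x‖₊ : ℝ≥0∞) ^ 2} := by
    intro x hx
    refine Set.mem_ofPred.2 (pow_le_pow_left' ?_ 2)
    rw [← enorm_eq_nnnorm, ← ofReal_norm]
    exact ENNReal.ofReal_le_ofReal (le_of_lt hx)
  refine (measure_mono hsub).trans ((meas_ge_le_lintegral_div (by fun_prop)
    (by simpa using hr) (by finiteness)).trans ?_)
  gcongr
  exact hS μ hμ

end Auxiliary

/-- Abstract core of the paper's convergence theorem for branched SVGD: if `(μ n)` is a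
sequence of probability measures on `ℝ^d` with uniformly bounded second moments, and each
`μ n` is coupled (with quadratic transport cost tending to `0`) to a probability measure
`ν n` which is absolutely continuous with density bounded a.e. by a locally integrable `χ`,
then every weakly convergent subsequence of `(μ n)` has a limit which is absolutely
continuous with density bounded a.e. by `χ`, and at least one weakly convergent subsequence
exists. -/
theorem bsvgd_subsequential_limits_absolutely_continuous
    (d : ℕ) (χ : EuclideanSpace ℝ (Fin d) → NNReal)
    (hχ : LocallyIntegrable (fun x => (χ x : ℝ))
      (volume : Measure (EuclideanSpace ℝ (Fin d))))
    (μ ν : ℕ → Measure (EuclideanSpace ℝ (Fin d)))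
    (hμprob : ∀ n, IsProbabilityMeasure (μ n))
    (C : ENNReal) (hC : C ≠ ⊤)
    (h2 : ∀ n, ∫⁻ x, (‖x‖₊ : ENNReal) ^ 2 ∂(μ n) ≤ C)
    (hνprob : ∀ n, IsProbabilityMeasure (ν n))
    (hνac : ∀ n, ν n ≪ (volume : Measure (EuclideanSpace ℝ (Fin d))))
    (hνbd : ∀ n, ∀ᵐ x ∂(volume : Measure (EuclideanSpace ℝ (Fin d))),
      (ν n).rnDeriv volume x ≤ (χ x : ENNReal))
    (π : ℕ → Measure (EuclideanSpace ℝ (Fin d) × EuclideanSpace ℝ (Fin d)))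
    (hπprob : ∀ n, IsProbabilityMeasure (π n))
    (hfst : ∀ n, (π n).map Prod.fst = μ n)
    (hsnd : ∀ n, (π n).map Prod.snd = ν n)
    (hcost : Tendsto (fun n => ∫⁻ p, (‖p.1 - p.2‖₊ : ENNReal) ^ 2 ∂(π n)) atTop (𝓝 0)) :
    (∀ (τ : Measure (EuclideanSpace ℝ (Fin d))) (φ : ℕ → ℕ), StrictMono φ →
        IsProbabilityMeasure τ →
        (∀ f : BoundedContinuousFunction (EuclideanSpace ℝ (Fin d)) ℝ,
          Tendsto (fun k => ∫ x, f x ∂(μ (φ k))) atTop (𝓝 (∫ x, f x ∂τ))) →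
        τ ≪ (volume : Measure (EuclideanSpace ℝ (Fin d))) ∧
          (∀ᵐ x ∂(volume : Measure (EuclideanSpace ℝ (Fin d))),
            τ.rnDeriv volume x ≤ (χ x : ENNReal))) ∧
      ∃ (τ : Measure (EuclideanSpace ℝ (Fin d))) (φ : ℕ → ℕ),
        IsProbabilityMeasure τ ∧ StrictMono φ ∧
        ∀ f : BoundedContinuousFunction (EuclideanSpace ℝ (Fin d)) ℝ,
          Tendsto (fun k => ∫ x, f x ∂(μ (φ k))) atTop (𝓝 (∫ x, f x ∂τ)) := by
  have hνle (n : ℕ) : ν n ≤ volume.withDensity fun x => (χ x : ℝ≥0∞) := by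
    rw [← Measure.withDensity_rnDeriv_eq _ _ (hνac n)]
    exact withDensity_mono (hνbd n)
  refine ⟨fun τ φ hφ hτ hlim => ?_, ?_⟩
  · have := isLocallyFiniteMeasure_withDensity_of_locallyIntegrable hχ
    have hconv : Tendsto (β := ProbabilityMeasure (EuclideanSpace ℝ (Fin d)))
        (fun k => ⟨μ (φ k), hμprob _⟩) atTop (𝓝 ⟨τ, hτ⟩) :=
      ProbabilityMeasure.tendsto_iff_forall_integral_tendsto.2 hlim
    have hτle : τ ≤ volume.withDensity fun x => (χ x : ℝ≥0∞) :=
      le_of_coupling_of_tendsto_zero hconv (π := fun k => π (φ k)) (fun k => hfst _)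
        (fun k => (hsnd _).trans_le (hνle _)) (hcost.comp hφ.tendsto_atTop)
    have hτac := hτle.absolutelyContinuous.trans (withDensity_absolutelyContinuous volume _)
    refine ⟨hτac, ae_le_of_forall_setLIntegral_le_of_sigmaFinite
      (Measure.measurable_rnDeriv τ volume) fun s hs _ => ?_⟩
    rw [← withDensity_apply _ hs, ← withDensity_apply _ hs,
      Measure.withDensity_rnDeriv_eq _ _ hτac]
    exact hτle s
  · let P (n : ℕ) : ProbabilityMeasure (EuclideanSpace ℝ (Fin d)) := ⟨μ n, hμprob n⟩
    have htight : IsTightMeasureSet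
        {(ρ : Measure (EuclideanSpace ℝ (Fin d))) | ρ ∈ Set.range P} := by
      refine isTightMeasureSet_of_lintegral_nnnorm_sq_le hC ?_
      rintro _ ⟨_, ⟨n, rfl⟩, rfl⟩
      exact h2 n
    obtain ⟨τ, -, φ, hφ, hlim⟩ := (isCompact_closure_of_isTightMeasureSet htight).isSeqCompact
      (x := P) fun n => subset_closure ⟨n, rfl⟩
    exact ⟨τ, φ, τ.2, hφ, ProbabilityMeasure.tendsto_iff_forall_integral_tendsto.1 hlim⟩
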